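/- Let p ≥ 3 be prime, m ∈ {3, 4}, and F(x) = x^m + A x^{m-1} + B with A = 4p^2 u + 1 and B = 2pt + p for integers u, t such that B and D = m^m B - (-1)^m (m-1)^{m-1} A^m are squarefree and |B| ≥ 2. Then for every integer n ≥ 0, F(x^{p^n}) is monogenic. -/

import Mathlib

open Polynomial

/-- If `W(θ) ∈ P` and `W'(θ) ∉ P`, then `q` and `W(θ)` generate `P` locally at `P`. -/
theorem exists_notMem_mul_aeval_mem_span_pair {S : Type*} [CommRing S] (θ : S) (P : Ideal S)
    [P.IsPrime] (q : ℕ) (hq : q.Prime) (hqP : (q : S) ∈ P) (W : ℤ[X]) (hW : aeval θ W ∈ P)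
    (hW' : aeval θ (derivative W) ∉ P) (f : ℤ[X]) (hf : aeval θ f ∈ P) :
    ∃ s ∉ P, ∃ a b : S, s * aeval θ f = aeval θ W * a + q * b := by
  have := Fact.mk hq
  let φ := Int.castRingHom (ZMod q)
  have hφ : Function.Surjective (Polynomial.map φ) :=
    Polynomial.map_surjective _ (ZMod.ringHom_surjective φ)
  have hker : ∀ g₁ g₂ : ℤ[X], g₁.map φ = g₂.map φ → ∃ k : ℤ[X], g₁ = g₂ + C (q : ℤ) * k := by
    intro g₁ g₂ h
    have : C (q : ℤ) ∣ g₁ - g₂ := by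
      rw [C_dvd_iff_dvd_coeff]
      intro i
      rw [← ZMod.intCast_zmod_eq_zero_iff_dvd]
      have := congrArg (fun r => r.coeff i) h
      simp only [coeff_map, φ, eq_intCast] at this
      simp [this]
    obtain ⟨k, hk⟩ := this
    exact ⟨k, by rw [← hk]; ring⟩
  have hgcd := EuclideanDomain.gcd_eq_gcd_ab (f.map φ) (W.map φ)
  obtain ⟨u, hu⟩ := hφ (EuclideanDomain.gcdA (f.map φ) (W.map φ))
  obtain ⟨v, hv⟩ := hφ (EuclideanDomain.gcdB (f.map φ) (W.map φ))
  obtain ⟨h₀, hh⟩ := EuclideanDomain.gcd_dvd_right (f.map φ) (W.map φ)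
  obtain ⟨l₀, hl⟩ := EuclideanDomain.gcd_dvd_left (f.map φ) (W.map φ)
  obtain ⟨h, rfl⟩ := hφ h₀
  obtain ⟨l, rfl⟩ := hφ l₀
  rw [← hu, ← hv] at hgcd
  generalize EuclideanDomain.gcd (f.map φ) (W.map φ) = d₀ at *
  obtain ⟨k, hk⟩ := hker W ((f * u + W * v) * h) (by
    rw [Polynomial.map_mul, Polynomial.map_add, Polynomial.map_mul, Polynomial.map_mul, ← hgcd]
    exact hh)
  obtain ⟨j, hj⟩ := hker f ((f * u + W * v) * l) (by
    rw [Polynomial.map_mul, Polynomial.map_add, Polynomial.map_mul, Polynomial.map_mul, ← hgcd]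
    exact hl)
  set d := f * u + W * v with hd
  have hdP : aeval θ d ∈ P := by
    simp only [hd, map_add, map_mul]
    exact P.add_mem (P.mul_mem_right _ hf) (P.mul_mem_right _ hW)
  refine ⟨aeval θ h, fun hhP => hW' ?_, aeval θ l, aeval θ (h * j - l * k), ?_⟩
  · rw [hk]
    rw [derivative_add, derivative_mul, derivative_C_mul]
    simp only [map_add, map_mul, map_natCast]
    exact P.add_mem (P.add_mem (P.mul_mem_left _ hhP) (P.mul_mem_right _ hdP))
      (P.mul_mem_right _ hqP)
  · have e : h * f = W * l + C (q : ℤ) * (h * j - l * k) := by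
      linear_combination h * hj - l * hk
    simpa using congrArg (aeval θ) e

/-- An element of `P` that generates `P` locally generates the maximal ideal of the localization. -/
theorem isPrincipal_maximalIdeal_localization {S : Type*} [CommRing S] (P : Ideal S) [P.IsPrime]
    (π : S) (hπ : π ∈ P) (h : ∀ z ∈ P, ∃ s ∉ P, π ∣ s * z) :
    (IsLocalRing.maximalIdeal (Localization.AtPrime P)).IsPrincipal := by
  refine ⟨⟨algebraMap S _ π, le_antisymm ?_ ?_⟩⟩
  · rw [← Localization.AtPrime.map_eq_maximalIdeal, Ideal.map_le_iff_le_comap]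
    intro z hz
    obtain ⟨s, hs, c, hc⟩ := h z hz
    have hu : IsUnit (algebraMap S (Localization.AtPrime P) s) :=
      IsLocalization.map_units (M := P.primeCompl) _ ⟨s, hs⟩
    rw [Ideal.mem_comap]
    refine Ideal.mem_span_singleton.2 ?_
    rw [← hu.dvd_mul_left, ← map_mul, hc, map_mul]
    exact dvd_mul_right _ _
  · rw [← Localization.AtPrime.map_eq_maximalIdeal, Submodule.span_singleton_le_iff_mem]
    exact Ideal.mem_map_of_mem _ hπ

/-- A criterion for an order generated by one element to be integrally closed. -/
theorem isIntegrallyClosed_of_adjoin_singleton_eq_top {S : Type*} [CommRing S] [IsDomain S]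
    (θ : S) (hθ : IsIntegral ℤ θ) (htop : Algebra.adjoin ℤ {θ} = ⊤)
    (h : ∀ (P : Ideal S) (_ : P.IsPrime) (q : ℕ) (_ : q.Prime) (_ : (q : S) ∈ P),
      ∃ W : ℤ[X], aeval θ W ∈ P ∧ aeval θ (derivative W) ∉ P ∧
        (aeval θ W = 0 ∨ ∃ s ∉ P, aeval θ W ∣ s * q)) :
    IsIntegrallyClosed S := by
  have hsurj : Function.Surjective (aeval (R := ℤ) θ) := by
    rw [← AlgHom.range_eq_top, ← Algebra.adjoin_singleton_eq_range_aeval, htop]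
  have : IsNoetherianRing S := isNoetherianRing_of_surjective _ _ (aeval (R := ℤ) θ).toRingHom hsurj
  have hint : Algebra.IsIntegral ℤ S := by
    refine ⟨fun x => ?_⟩
    have hx : x ∈ Algebra.adjoin ℤ {θ} := htop ▸ Algebra.mem_top
    exact Algebra.adjoin_le (S := integralClosure ℤ S) (Set.singleton_subset_iff.2 hθ) hx
  have : IsDedekindDomainDvr S := by
    refine { is_dvr_at_nonzero_prime := fun P hP hPp => ?_ }
    obtain ⟨q, hq, hqP⟩ : ∃ q : ℕ, q.Prime ∧ (q : S) ∈ P := by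
      have hne : P.comap (algebraMap ℤ S) ≠ ⊥ := fun h => hP (Ideal.eq_bot_of_comap_eq_bot h)
      have hpr := Submodule.IsPrincipal.prime_generator_of_isPrime _ hne
      refine ⟨_, Int.prime_iff_natAbs_prime.1 hpr, ?_⟩
      have hm : algebraMap ℤ S _ ∈ P :=
        Submodule.IsPrincipal.generator_mem (P.comap (algebraMap ℤ S))
      generalize Submodule.IsPrincipal.generator (P.comap (algebraMap ℤ S)) = g at hm
      rcases Int.natAbs_eq g with e | e <;> rw [e] at hm <;> simpa using hm
    have hnf : ¬ IsField (Localization.AtPrime P) := by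
      rw [IsLocalRing.isField_iff_maximalIdeal_eq, ← Localization.AtPrime.map_eq_maximalIdeal,
        Ideal.map_eq_bot_iff_of_injective
          (IsLocalization.injective _ P.primeCompl_le_nonZeroDivisors)]
      exact hP
    refine ((IsDiscreteValuationRing.TFAE _ hnf).out 0 4).2 ?_
    obtain ⟨W, hW, hW', hcase⟩ := h P hPp q hq hqP
    have key := exists_notMem_mul_aeval_mem_span_pair θ P q hq hqP W hW hW'
    rcases hcase with h0 | ⟨s, hs, c, hc⟩
    · refine isPrincipal_maximalIdeal_localization P q hqP fun z hz => ?_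
      obtain ⟨f, rfl⟩ := hsurj z
      obtain ⟨s, hs, a, b, hab⟩ := key f hz
      exact ⟨s, hs, b, by rw [hab, h0]; ring⟩
    · refine isPrincipal_maximalIdeal_localization P _ hW fun z hz => ?_
      obtain ⟨f, rfl⟩ := hsurj z
      obtain ⟨s', hs', a, b, hab⟩ := key f hz
      refine ⟨s * s', hPp.mul_notMem hs hs', s * a + c * b, ?_⟩
      linear_combination s * hab + b * hc
  infer_instance

theorem adjoin_eq_top_of_isIntegrallyClosed {K : Type*} [Field K] [NumberField K]
    (θ : NumberField.RingOfIntegers K) (hK : Algebra.adjoin ℚ {(θ : K)} = ⊤)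
    (hcl : IsIntegrallyClosed (Algebra.adjoin ℤ {θ})) : Algebra.adjoin ℤ {θ} = ⊤ := by
  set S := Algebra.adjoin ℤ {θ}
  have hden : ∀ z : K, ∃ (d : ℤ) (s : S), d ≠ 0 ∧ d * z = algebraMap S K s := by
    intro z
    have hz : z ∈ Algebra.adjoin ℚ {(θ : K)} := hK ▸ Algebra.mem_top
    induction hz using Algebra.adjoin_induction with
    | mem x hx =>
      obtain rfl := hx
      exact ⟨1, ⟨θ, Algebra.self_mem_adjoin_singleton ℤ θ⟩, one_ne_zero, by simp⟩
    | algebraMap r =>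
      refine ⟨r.den, (r.num : S), by simp, ?_⟩
      rw [map_intCast, eq_ratCast]
      exact_mod_cast congrArg (Rat.cast (K := K)) (Rat.den_mul_eq_num r)
    | add x y _ _ hx hy =>
      obtain ⟨d, s, hd, h⟩ := hx
      obtain ⟨d', s', hd', h'⟩ := hy
      refine ⟨d * d', d' * s + d * s', mul_ne_zero hd hd', ?_⟩
      simp only [map_add, map_mul, map_intCast, ← h, ← h']
      push_cast
      ring
    | mul x y _ _ hx hy =>
      obtain ⟨d, s, hd, h⟩ := hx
      obtain ⟨d', s', hd', h'⟩ := hy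
      refine ⟨d * d', s * s', mul_ne_zero hd hd', ?_⟩
      simp only [map_mul, ← h, ← h']
      push_cast
      ring
  have : FaithfulSMul S K := by
    rw [faithfulSMul_iff_algebraMap_injective]
    exact (FaithfulSMul.algebraMap_injective (NumberField.RingOfIntegers K) K).comp
      Subtype.val_injective
  have : IsFractionRing S K := IsFractionRing.of_field _ _ fun z => by
    obtain ⟨d, s, hd, h⟩ := hden z
    refine ⟨s, d, ?_⟩
    have : (d : K) ≠ 0 := by exact_mod_cast hd
    rw [← h, map_intCast]
    field_simp
  rw [eq_top_iff]
  intro α _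
  have hα : IsIntegral S (α : K) := (NumberField.RingOfIntegers.isIntegral_coe α).tower_top
  obtain ⟨s, hs⟩ := IsIntegrallyClosed.isIntegral_iff.1 hα
  have : (s : NumberField.RingOfIntegers K) = α := NumberField.RingOfIntegers.coe_injective hs
  exact this ▸ s.2

theorem irreducible_X_pow_four_add_X_pow_three_add_one :
    Irreducible (X ^ 4 + X ^ 3 + 1 : (ZMod 2)[X]) := by
  have hdeg : (X ^ 4 + X ^ 3 + 1 : (ZMod 2)[X]).natDegree = 4 := by compute_degree!
  have hmon : (X ^ 4 + X ^ 3 + 1 : (ZMod 2)[X]).Monic := by monicity!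
  have hroot : ∀ c : ZMod 2, ∀ q : (ZMod 2)[X], q ∣ X ^ 4 + X ^ 3 + 1 → q.eval c ≠ 0 := by
    intro c q hq h0
    have : (X ^ 4 + X ^ 3 + 1 : (ZMod 2)[X]).eval c = 0 := eval_eq_zero_of_dvd_of_eval_eq_zero hq h0
    simp only [eval_add, eval_pow, eval_X, eval_one] at this
    exact (by decide : ∀ c : ZMod 2, c ^ 4 + c ^ 3 + 1 ≠ 0) c this
  rw [hmon.irreducible_iff_lt_natDegree_lt (fun h => by simp [h] at hdeg), hdeg]
  intro q hq hqd hdvd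
  have h2 : q.natDegree = 1 ∨ q.natDegree = 2 := by
    rw [Finset.mem_Ioc] at hqd
    omega
  rcases h2 with h1 | h2
  · refine hroot (q.coeff 0) q hdvd ?_
    rw [hq.as_sum, h1]
    simpa using CharTwo.add_self_eq_zero (q.coeff 0)
  · have e := hq.as_sum
    rw [h2] at e
    simp only [Finset.sum_range_succ, Finset.sum_range_zero, pow_zero, pow_one, mul_one,
      zero_add] at e
    have r0 := hroot 0 q hdvd
    have r1 := hroot 1 q hdvd
    rw [e] at r0 r1
    simp only [eval_add, eval_mul, eval_pow, eval_X, eval_C, mul_one, one_pow, mul_zero, ne_eq,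
      OfNat.ofNat_ne_zero, not_false_eq_true, zero_pow, zero_add, add_zero] at r0 r1
    have : q.coeff 0 = 1 ∧ q.coeff 1 = 1 := by
      revert r0 r1
      generalize q.coeff 0 = b
      generalize q.coeff 1 = a
      revert a b
      decide
    rw [this.1, this.2, C_1] at e
    have hX : q ∣ X := by
      have : (X : (ZMod 2)[X]) = q * (X ^ 2 + 1) - (X ^ 4 + X ^ 3 + 1) := by
        rw [e]
        have h2 : (2 : (ZMod 2)[X]) = 0 := CharTwo.two_eq_zero
        linear_combination (-X ^ 2) * h2
      rw [this]
      exact dvd_sub (dvd_mul_right _ _) hdvd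
    have := natDegree_le_of_dvd hX X_ne_zero
    rw [h2, natDegree_X] at this
    omega

theorem irreducible_X_pow_three_add_X_pow_two_add_one :
    Irreducible (X ^ 3 + X ^ 2 + 1 : (ZMod 2)[X]) := by
  have hdeg : (X ^ 3 + X ^ 2 + 1 : (ZMod 2)[X]).natDegree = 3 := by compute_degree!
  refine irreducible_of_degree_le_three_of_not_isRoot (by simp [hdeg]) ?_
  simp only [IsRoot.def, eval_add, eval_pow, eval_X, eval_one]
  decide

theorem exists_pow_eq_coeff_zero_minpoly {K E : Type*} [Field K] [Field E] [Algebra K E] {x : E}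
    (hx : IsIntegral K x) {b : IntermediateField.adjoin K {x}} {k : ℕ}
    (hb : b ^ k = IntermediateField.AdjoinSimple.gen K x) :
    ∃ r : K, r ^ k = (-1) ^ (minpoly K x).natDegree * (minpoly K x).coeff 0 := by
  refine ⟨Algebra.norm K b, ?_⟩
  rw [← map_pow, hb, ← IntermediateField.adjoin.powerBasis_gen hx,
    Algebra.PowerBasis.norm_gen_eq_coeff_zero_minpoly, IntermediateField.adjoin.powerBasis_gen,
    IntermediateField.minpoly_gen, IntermediateField.adjoin.powerBasis_dim]

/-- Substituting `X ^ p ^ n` into an irreducible monic polynomial over `ℤ` preserves irreducibility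
when the constant term is divisible by `p` exactly once. -/
theorem irreducible_comp_X_pow_prime_pow {p : ℕ} (hp : p.Prime) (hp2 : p ≠ 2) (f : ℤ[X])
    (hm : f.Monic) (hf : Irreducible f) (hdvd : (p : ℤ) ∣ f.coeff 0)
    (hndvd : ¬ (p : ℤ) ^ 2 ∣ f.coeff 0) (n : ℕ) :
    Irreducible ((f.comp (X ^ p ^ n)).map (Int.castRingHom ℚ)) := by
  have hf' : Irreducible (f.map (Int.castRingHom ℚ)) :=
    (hm.irreducible_iff_irreducible_map_fraction_map (K := ℚ)).1 hf
  rw [Polynomial.map_comp, Polynomial.map_pow, map_X]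
  refine irreducible_comp (hm.map _) (monic_X_pow _) hf' fun E _ _ x hx => ?_
  rw [Polynomial.map_pow, map_X]
  refine X_pow_sub_C_irreducible_of_prime_pow hp hp2 n fun b hb => ?_
  have hxi : IsIntegral ℚ x := by
    by_contra h
    rw [minpoly.eq_zero h] at hx
    exact hf'.ne_zero hx.symm
  obtain ⟨r, hN⟩ := exists_pow_eq_coeff_zero_minpoly hxi hb
  rw [hx, coeff_map, eq_intCast] at hN
  have := Fact.mk hp
  have hv := congrArg (padicValRat p) hN
  have h0 : f.coeff 0 ≠ 0 := fun h => hndvd (h ▸ dvd_zero _)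
  have hb0 : r ≠ 0 := by
    intro h
    rw [h, zero_pow hp.ne_zero] at hN
    have : (f.coeff 0 : ℚ) ≠ 0 := by exact_mod_cast h0
    exact (mul_ne_zero (pow_ne_zero _ (by norm_num)) this) hN.symm
  have h1 : padicValInt p (f.coeff 0) = 1 := by
    apply le_antisymm
    · by_contra h
      exact hndvd ((padicValInt_dvd_iff 2 _).2 (Or.inr (by omega)))
    · exact ((padicValInt_dvd_iff 1 _).1 (by simpa using hdvd)).resolve_left h0
  rw [padicValRat.pow, padicValRat.mul (pow_ne_zero _ (by norm_num)) (by exact_mod_cast h0),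
    padicValRat.of_int, h1, padicValRat.pow, padicValRat.neg, padicValRat.one] at hv
  have : (p : ℤ) ∣ 1 := ⟨_, by rw [hv]; simp⟩
  exact hp.one_lt.ne' (by exact_mod_cast Int.eq_one_of_dvd_one (by positivity) this)

theorem irreducible_trinomial {m : ℕ} (hm : m = 3 ∨ m = 4) {A B : ℤ} (hA : Odd A) (hB : Odd B) :
    Irreducible (X ^ m + C A * X ^ (m - 1) + C B : ℤ[X]) := by
  have hA' : (A : ZMod 2) = 1 := ZMod.intCast_eq_one_iff_odd.2 hA
  have hB' : (B : ZMod 2) = 1 := ZMod.intCast_eq_one_iff_odd.2 hB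
  refine Monic.irreducible_of_irreducible_map (Int.castRingHom (ZMod 2)) _ ?_ ?_
  · rcases hm with rfl | rfl <;> norm_num <;> monicity!
  · rcases hm with rfl | rfl
    · simpa only [Polynomial.map_add, Polynomial.map_mul, Polynomial.map_pow, map_X, map_C,
        Int.coe_castRingHom, hA', hB', C_1, one_mul, Nat.add_one_sub_one,
        Nat.reduceSub] using irreducible_X_pow_three_add_X_pow_two_add_one
    · simpa only [Polynomial.map_add, Polynomial.map_mul, Polynomial.map_pow, map_X, map_C,
        Int.coe_castRingHom, hA', hB', C_1, one_mul, Nat.add_one_sub_one,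
        Nat.reduceSub] using irreducible_X_pow_four_add_X_pow_three_add_one

theorem Squarefree.not_natCast_dvd_of_eq_mul {a b : ℤ} (ha : Squarefree a) {q : ℕ}
    (hq : q.Prime) (hab : a = q * b) : ¬ (q : ℤ) ∣ b := by
  rintro ⟨c, rfl⟩
  have h := ha q ⟨c, by rw [hab]; ring⟩
  exact (Nat.prime_iff_prime_int.1 hq).not_isUnit h

theorem Ideal.natCast_dvd_of_intCast_mem {S : Type*} [CommRing S] {P : Ideal S} [P.IsPrime]
    {q : ℕ} (hq : q.Prime) (hqP : (q : S) ∈ P) {a : ℤ} (ha : (a : S) ∈ P) : (q : ℤ) ∣ a := by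
  by_contra h
  obtain ⟨x, y, hxy⟩ := ((Nat.prime_iff_prime_int.1 hq).coprime_iff_not_dvd.2 h)
  refine Ideal.IsPrime.one_notMem (I := P) inferInstance ?_
  have : (1 : S) = x * q + y * a := by exact_mod_cast (congrArg (Int.cast (R := S)) hxy).symm
  rw [this]
  exact P.add_mem (P.mul_mem_left _ hqP) (P.mul_mem_left _ ha)

/-- The discriminant factor of a trinomial lies in the square of the derivative factor at a root. -/
theorem exists_discr_factor_eq_sq_mul {S : Type*} [CommRing S] {m : ℕ} (hm : m = 3 ∨ m = 4)
    (A B : ℤ) (y : S) (hy : y ^ m + A * y ^ (m - 1) + B = 0) :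
    ∃ r : S, (((m : ℤ) ^ m * B - (-1) ^ m * ((m : ℤ) - 1) ^ (m - 1) * A ^ m : ℤ) : S) =
      (m * y + (m - 1) * A) ^ 2 * r := by
  rcases hm with rfl | rfl
  · refine ⟨3 * A - (3 * y + 2 * A), ?_⟩
    push_cast
    linear_combination 27 * hy
  · refine ⟨-((4 * y + 3 * A) ^ 2 - 8 * A * (4 * y + 3 * A) + 18 * A ^ 2), ?_⟩
    push_cast
    linear_combination 256 * hy

/-- The local condition for the order generated by a root of a power-compositional trinomial. -/
theorem exists_local_uniformizer_of_trinomial {S : Type*} [CommRing S] {p : ℕ} (hp : p.Prime)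
    (hp2 : p ≠ 2) {m : ℕ} (hm : m = 3 ∨ m = 4) {A B : ℤ} (hA : (p : ℤ) ^ 2 ∣ A - 1)
    (hpB : (p : ℤ) ∣ B) (hBsf : Squarefree B)
    (hDsf : Squarefree ((m : ℤ) ^ m * B - (-1) ^ m * ((m : ℤ) - 1) ^ (m - 1) * A ^ m))
    (n : ℕ) (θ : S)
    (hθ : aeval θ ((X ^ m + C A * X ^ (m - 1) + C B : ℤ[X]).comp (X ^ p ^ n)) = 0)
    (P : Ideal S) (hP : P.IsPrime) (q : ℕ) (hq : q.Prime) (hqP : (q : S) ∈ P) :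
    ∃ W : ℤ[X], aeval θ W ∈ P ∧ aeval θ (derivative W) ∉ P ∧
      (aeval θ W = 0 ∨ ∃ s ∉ P, aeval θ W ∣ s * q) := by
  have hdvd : ∀ a : ℤ, (a : S) ∈ P → (q : ℤ) ∣ a := fun a ha =>
    Ideal.natCast_dvd_of_intCast_mem hq hqP ha
  have hN : p ^ n ≠ 0 := pow_ne_zero _ hp.ne_zero
  have hy : (θ ^ p ^ n) ^ m + A * (θ ^ p ^ n) ^ (m - 1) + B = 0 := by
    simpa [aeval_comp] using hθ
  by_cases hθP : θ ∈ P
  · have hBP : (B : S) ∈ P := by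
      rw [show (B : S) = -(θ ^ p ^ n * ((θ ^ p ^ n) ^ (m - 1) + A * (θ ^ p ^ n) ^ (m - 2))) by
        rcases hm with rfl | rfl <;> linear_combination hy]
      exact P.neg_mem (P.mul_mem_right _ (P.pow_mem_of_mem hθP _ (Nat.pos_of_ne_zero hN)))
    obtain ⟨b, hb⟩ := hdvd _ hBP
    refine ⟨X, by simpa, by simpa using hP.one_notMem, Or.inr ⟨b, fun h => ?_, ?_⟩⟩
    · exact hBsf.not_natCast_dvd_of_eq_mul hq hb (hdvd _ h)
    · rw [aeval_X]
      refine (dvd_pow_self θ hN).trans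
        ⟨-((θ ^ p ^ n) ^ (m - 1) + A * (θ ^ p ^ n) ^ (m - 2)), ?_⟩
      have hb' := congrArg (Int.cast (R := S)) hb
      push_cast at hb'
      rcases hm with rfl | rfl <;> linear_combination hy - hb'
  have hyP : θ ^ p ^ n ∉ P := fun h => hθP (hP.mem_of_pow_mem _ h)
  by_cases hqp : q = p
  · subst hqp
    obtain ⟨b, hb⟩ := hpB
    obtain ⟨a, ha⟩ := hA
    have hb' := congrArg (Int.cast (R := S)) hb
    have ha' := congrArg (Int.cast (R := S)) ha
    push_cast at hb' ha'
    have hy1 : θ ^ q ^ n + 1 ∈ P := by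
      refine (hP.mem_or_mem (?_ : (θ ^ q ^ n) ^ (m - 1) * (θ ^ q ^ n + 1) ∈ P)).resolve_left
        fun h => hyP (hP.mem_of_pow_mem _ h)
      rw [show (θ ^ q ^ n) ^ (m - 1) * (θ ^ q ^ n + 1) =
        -(q * (b + q * a * (θ ^ q ^ n) ^ (m - 1))) by
          rcases hm with rfl | rfl
          · linear_combination hy - hb' - (θ ^ q ^ n) ^ 2 * ha'
          · linear_combination hy - hb' - (θ ^ q ^ n) ^ 3 * ha']
      exact P.neg_mem (P.mul_mem_right _ hqP)
    have hθ1 : θ + 1 ∈ P := by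
      obtain ⟨r, hr⟩ := exists_add_pow_prime_pow_eq hp θ 1 n
      refine hP.mem_of_pow_mem (q ^ n) ?_
      rw [hr, one_pow, mul_assoc, mul_assoc]
      exact P.add_mem hy1 (P.mul_mem_right _ hqP)
    obtain ⟨c, hc⟩ : θ + 1 ∣ θ ^ q ^ n + 1 := by
      simpa using (hp.odd_of_ne_two hp2).pow.add_dvd_pow_add_pow θ 1
    have hbq := hBsf.not_natCast_dvd_of_eq_mul hq hb
    refine ⟨X + 1, by simpa, by simpa using hP.one_notMem,
      Or.inr ⟨((b - (-1) ^ m * q * a : ℤ) : S), fun h => ?_, ?_⟩⟩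
    · refine hbq ((Int.dvd_iff_dvd_of_dvd_sub ?_).1 (hdvd _ h))
      exact ⟨-((-1) ^ m * a), by ring⟩
    · simp only [map_add, aeval_X, map_one]
      refine Dvd.dvd.trans ⟨c, hc⟩ ?_
      generalize θ ^ q ^ n = y at *
      rcases hm with rfl | rfl
      · refine ⟨-(y ^ 2 + (A - 1) * (y - 1)), ?_⟩
        push_cast
        linear_combination hy - hb' - ha'
      · refine ⟨-(y ^ 3 + (A - 1) * (y ^ 2 - y + 1)), ?_⟩
        push_cast
        linear_combination hy - hb' + ha'
  have hNP : ((p ^ n : ℕ) : S) ∉ P := by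
    intro h
    have := hdvd (p ^ n : ℕ) (by exact_mod_cast h)
    exact hqp ((Nat.prime_dvd_prime_iff_eq hq hp).1
      (hq.dvd_of_dvd_pow (by exact_mod_cast this)))
  have hNP' : ((p ^ n : ℕ) : S) * θ ^ (p ^ n - 1) ∉ P :=
    hP.mul_notMem hNP fun h => hθP (hP.mem_of_pow_mem _ h)
  set w : S := m * θ ^ p ^ n + (m - 1) * A with hw
  by_cases hwP : w ∈ P
  · obtain ⟨r, hr⟩ := exists_discr_factor_eq_sq_mul hm A B _ hy
    rw [← hw] at hr
    obtain ⟨d, hd⟩ := hdvd _ (by rw [hr, sq, mul_assoc]; exact P.mul_mem_right _ hwP)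
    have hdq := hDsf.not_natCast_dvd_of_eq_mul hq hd
    have hmP : ((m : ℕ) : S) ∉ P := by
      intro h
      have hqm : (q : ℤ) ∣ m := hdvd m (by exact_mod_cast h)
      have hqA : (q : ℤ) ∣ ((m : ℤ) - 1) * A := by
        apply hdvd
        have := P.sub_mem hwP (P.mul_mem_right (θ ^ p ^ n) h)
        rw [hw] at this
        push_cast
        simpa using this
      have hqA' : (q : ℤ) ∣ A := by
        refine ((Nat.prime_iff_prime_int.1 hq).dvd_or_dvd hqA).resolve_left fun h1 => ?_
        have := dvd_sub hqm h1
        rw [sub_sub_cancel] at this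
        exact (Nat.prime_iff_prime_int.1 hq).not_dvd_one this
      have h2 : ∀ x : ℤ, (q : ℤ) ∣ x → (q : ℤ) * q ∣ x ^ m := fun x hx => by
        rw [← sq]
        exact (pow_dvd_pow_of_dvd hx 2).trans (pow_dvd_pow x (by omega))
      refine (Nat.prime_iff_prime_int.1 hq).not_isUnit (hDsf q (dvd_sub ?_ ?_))
      · exact (h2 _ hqm).mul_right _
      · exact (h2 _ hqA').mul_left _
    have hev : aeval θ (C (m : ℤ) * X ^ p ^ n + C (((m : ℤ) - 1) * A)) = w := by
      simp [hw]
    refine ⟨C (m : ℤ) * X ^ p ^ n + C (((m : ℤ) - 1) * A), by rwa [hev], ?_,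
      Or.inr ⟨d, fun h => hdq (hdvd _ h), ?_⟩⟩
    · rw [derivative_add, derivative_C, add_zero, derivative_C_mul, derivative_X_pow]
      simpa using hP.mul_notMem hmP hNP'
    · rw [hev]
      have hd' := congrArg (Int.cast (R := S)) hd
      rw [hr] at hd'
      push_cast at hd'
      exact ⟨w * r, by linear_combination -hd'⟩
  · refine ⟨_, by rw [hθ]; exact P.zero_mem, ?_, Or.inl hθ⟩
    have hder : aeval θ (derivative
        ((X ^ m + C A * X ^ (m - 1) + C B : ℤ[X]).comp (X ^ p ^ n))) =
        ((p ^ n : ℕ) : S) * θ ^ (p ^ n - 1) * ((θ ^ p ^ n) ^ (m - 2) * w) := by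
      rw [derivative_comp, derivative_X_pow]
      rcases hm with rfl | rfl <;>
      · simp [hw, map_ofNat (aeval (R := ℤ) θ)]
        ring
    rw [hder]
    exact hP.mul_notMem hNP' (hP.mul_notMem (fun h => hyP (hP.mem_of_pow_mem _ h)) hwP)

theorem stmt_13 (p : ℕ) (hp : p.Prime) (hp3 : 3 ≤ p) (m : ℕ) (hm : m = 3 ∨ m = 4)
    (u t : ℤ) (A B : ℤ)
    (hA : A = 4 * (p : ℤ) ^ 2 * u + 1) (hB : B = 2 * p * t + p)
    (hBsf : Squarefree B)
    (hDsf : Squarefree ((m : ℤ) ^ m * B - (-1) ^ m * ((m : ℤ) - 1) ^ (m - 1) * A ^ m))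
    (hB2 : 2 ≤ |B|) (n : ℕ) :
    Irreducible (((X ^ m + C A * X ^ (m - 1) + C B : Polynomial ℤ).comp (X ^ p ^ n)).map
        (Int.castRingHom ℚ)) ∧
      ∀ (K : Type) [Field K] [NumberField K] (θ : NumberField.RingOfIntegers K),
        Polynomial.aeval (θ : K)
            ((X ^ m + C A * X ^ (m - 1) + C B : Polynomial ℤ).comp (X ^ p ^ n)) = 0 →
        Algebra.adjoin ℚ {(θ : K)} = ⊤ →
        Algebra.adjoin ℤ {θ} = ⊤ := by
  have hp2 : p ≠ 2 := by omega
  have hpodd : Odd (p : ℤ) := by exact_mod_cast hp.odd_of_ne_two hp2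
  have hAodd : Odd A := ⟨2 * p ^ 2 * u, by rw [hA]; ring⟩
  have hBodd : Odd B := by
    rw [hB, mul_assoc]
    exact (even_two_mul _).add_odd hpodd
  have hpB : B = p * (2 * t + 1) := by rw [hB]; ring
  refine ⟨?_, fun K _ _ θ hθ hK => ?_⟩
  · have hcoeff : (X ^ m + C A * X ^ (m - 1) + C B : ℤ[X]).coeff 0 = B := by
      rcases hm with rfl | rfl <;> simp
    refine irreducible_comp_X_pow_prime_pow hp hp2 _ ?_ (irreducible_trinomial hm hAodd hBodd)
      ?_ ?_ n
    · rcases hm with rfl | rfl <;> norm_num <;> monicity!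
    · rw [hcoeff, hpB]
      exact dvd_mul_right _ _
    · rw [hcoeff, sq]
      exact fun h => (Nat.prime_iff_prime_int.1 hp).not_isUnit (hBsf _ h)
  · apply adjoin_eq_top_of_isIntegrallyClosed θ hK
    let θ' : Algebra.adjoin ℤ {θ} := ⟨θ, Algebra.self_mem_adjoin_singleton ℤ θ⟩
    have hθ' : aeval θ' ((X ^ m + C A * X ^ (m - 1) + C B : ℤ[X]).comp (X ^ p ^ n)) = 0 := by
      apply FaithfulSMul.algebraMap_injective (Algebra.adjoin ℤ {θ}) (NumberField.RingOfIntegers K)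
      apply FaithfulSMul.algebraMap_injective (NumberField.RingOfIntegers K) K
      rw [← aeval_algebraMap_apply, ← aeval_algebraMap_apply, map_zero, map_zero]
      exact hθ
    have htop : Algebra.adjoin ℤ {θ'} = ⊤ := by
      have := Algebra.adjoin_adjoin_coe_preimage (R := ℤ) (s := {θ})
      convert this
      ext x
      simp [θ', Subtype.ext_iff]
    refine isIntegrallyClosed_of_adjoin_singleton_eq_top θ' ?_ htop fun P hP q hq hqP =>
      exists_local_uniformizer_of_trinomial hp hp2 hm ⟨4 * u, by rw [hA]; ring⟩ ⟨_, hpB⟩ hBsf hDsf n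
        θ' hθ' P hP q hq hqP
    exact (isIntegral_algHom_iff (Algebra.adjoin ℤ {θ}).val Subtype.val_injective).1
      (NumberField.RingOfIntegers.isIntegral θ)
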